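/- Let m ≥ 2, 0 < a < b, and let f : ℝ → ℝ be continuously differentiable. Let u ∈ C²(Ā) be O(m)×O(m)-invariant, satisfy −Δu = f(u) in A and the Neumann condition ⟨∇u(x), x/|x|⟩ = 0 for all x ∈ ∂A. Define v : D̄ → ℝ by v(z',t) := u(√(|z|+t)·e₁, √(|z|−t)·e₁), where z = (z',t) ∈ ℝ^m × ℝ and e₁ ∈ ℝ^m is the first standard basis vector. Then v is twice continuously differentiable in D, axially symmetric about the axis e_{m+1}, satisfies −Δv(z) = f(v(z))/(2|z|) in D and the Neumann condition ⟨∇v(z), z/|z|⟩ = 0 for all z ∈ ∂D. -/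

import Mathlib

noncomputable section
open Real

/-- Euclidean norm on `ℝ^m × ℝ^m = ℝ^{2m}`. -/
def pnorm {m : ℕ} (x : EuclideanSpace ℝ (Fin m) × EuclideanSpace ℝ (Fin m)) : ℝ :=
  Real.sqrt (‖x.1‖ ^ 2 + ‖x.2‖ ^ 2)

/-- The Euclidean Laplacian of a function on `ℝ^m × ℝ^m = ℝ^{2m}`. -/
def lapP {m : ℕ} (f : EuclideanSpace ℝ (Fin m) × EuclideanSpace ℝ (Fin m) → ℝ)
    (x : EuclideanSpace ℝ (Fin m) × EuclideanSpace ℝ (Fin m)) : ℝ :=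
  (∑ i : Fin m,
    fderiv ℝ (fun y => fderiv ℝ f y ((EuclideanSpace.single i (1 : ℝ)), 0)) x
      ((EuclideanSpace.single i (1 : ℝ)), 0)) +
  ∑ i : Fin m,
    fderiv ℝ (fun y => fderiv ℝ f y (0, (EuclideanSpace.single i (1 : ℝ)))) x
      (0, (EuclideanSpace.single i (1 : ℝ)))

/-- The annulus `A = {a < |x| < b}` in `ℝ^{2m} = ℝ^m × ℝ^m`. -/
def Ann (m : ℕ) (a b : ℝ) : Set (EuclideanSpace ℝ (Fin m) × EuclideanSpace ℝ (Fin m)) :=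
  {x | a < pnorm x ∧ pnorm x < b}

/-- Euclidean norm on `ℝ^m × ℝ = ℝ^{m+1}`. -/
def qnorm {m : ℕ} (z : EuclideanSpace ℝ (Fin m) × ℝ) : ℝ :=
  Real.sqrt (‖z.1‖ ^ 2 + z.2 ^ 2)

/-- The Euclidean Laplacian of a function on `ℝ^m × ℝ = ℝ^{m+1}`. -/
def lapQ {m : ℕ} (f : EuclideanSpace ℝ (Fin m) × ℝ → ℝ)
    (z : EuclideanSpace ℝ (Fin m) × ℝ) : ℝ :=
  (∑ i : Fin m,
    fderiv ℝ (fun y => fderiv ℝ f y ((EuclideanSpace.single i (1 : ℝ)), 0)) z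
      ((EuclideanSpace.single i (1 : ℝ)), 0)) +
  fderiv ℝ (fun y => fderiv ℝ f y (0, (1 : ℝ))) z (0, (1 : ℝ))

/-- The annulus `D = {a²/2 < |z| < b²/2}` in `ℝ^{m+1} = ℝ^m × ℝ`. -/
def AnnD (m : ℕ) (a b : ℝ) : Set (EuclideanSpace ℝ (Fin m) × ℝ) :=
  {z | a ^ 2 / 2 < qnorm z ∧ qnorm z < b ^ 2 / 2}

open Filter Topology

abbrev EE (m : ℕ) := EuclideanSpace ℝ (Fin m)

lemma chain2 {E : Type*} [NormedAddCommGroup E] [NormedSpace ℝ E] (g : E → ℝ) (c c' : ℝ → E)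
    (c'' : E) (hg : ContDiffAt ℝ 2 g (c 0)) (hc : ∀ᶠ s in 𝓝 (0:ℝ), HasDerivAt c (c' s) s)
    (hc' : HasDerivAt c' c'' 0) :
    deriv (deriv (fun s => g (c s))) 0
      = fderiv ℝ (fderiv ℝ g) (c 0) (c' 0) (c' 0) + fderiv ℝ g (c 0) c'' := by
  have hc0 : HasDerivAt c (c' 0) 0 := hc.self_of_nhds
  have hgd : ∀ᶠ y in 𝓝 (c 0), DifferentiableAt ℝ g y := by
    filter_upwards [hg.eventually (by simp)] with y hy
    exact hy.differentiableAt (by simp)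
  have h1 : deriv (fun s => g (c s)) =ᶠ[𝓝 0] fun s => fderiv ℝ g (c s) (c' s) := by
    filter_upwards [hc, hc0.continuousAt.eventually hgd] with s h1 h2
    exact (h2.hasFDerivAt.comp_hasDerivAt s h1).deriv
  rw [h1.deriv_eq]
  have h2 : HasFDerivAt (fderiv ℝ g) (fderiv ℝ (fderiv ℝ g) (c 0)) (c 0) :=
    ((hg.fderiv_right (m := 1) (by norm_num)).differentiableAt (by simp)).hasFDerivAt
  exact ((h2.comp_hasDerivAt 0 hc0).clm_apply hc').deriv

lemma hess_apply {E : Type*} [NormedAddCommGroup E] [NormedSpace ℝ E] (g : E → ℝ) (x e e' : E)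
    (hg : ContDiffAt ℝ 2 g x) :
    fderiv ℝ (fun y => fderiv ℝ g y e) x e' = fderiv ℝ (fderiv ℝ g) x e' e := by
  have h2 : HasFDerivAt (fderiv ℝ g) (fderiv ℝ (fderiv ℝ g) x) x :=
    ((hg.fderiv_right (m := 1) (by norm_num)).differentiableAt (by simp)).hasFDerivAt
  have := (h2.clm_apply (hasFDerivAt_const e x)).fderiv
  rw [this]; simp

lemma hess_line {E : Type*} [NormedAddCommGroup E] [NormedSpace ℝ E] (g : E → ℝ) (x e : E)
    (hg : ContDiffAt ℝ 2 g x) :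
    fderiv ℝ (fun y => fderiv ℝ g y e) x e = deriv (deriv (fun s : ℝ => g (x + s • e))) 0 := by
  rw [hess_apply g x e e hg]
  have h : ∀ s : ℝ, HasDerivAt (fun s : ℝ => x + s • e) e s := fun s => by
    simpa using ((hasDerivAt_id s).smul_const e).const_add x
  have := chain2 g (fun s : ℝ => x + s • e) (fun _ => e) 0 (by simpa using hg)
    (Eventually.of_forall h) (hasDerivAt_const _ _)
  rw [this]; simp

lemma qnorm_nonneg {m : ℕ} (z : EE m × ℝ) : 0 ≤ qnorm z := Real.sqrt_nonneg _
lemma pnorm_nonneg {m : ℕ} (z : EE m × EE m) : 0 ≤ pnorm z := Real.sqrt_nonneg _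
lemma qnorm_sq {m : ℕ} (z : EE m × ℝ) : qnorm z ^ 2 = ‖z.1‖ ^ 2 + z.2 ^ 2 :=
  Real.sq_sqrt (by positivity)
lemma pnorm_sq {m : ℕ} (z : EE m × EE m) : pnorm z ^ 2 = ‖z.1‖ ^ 2 + ‖z.2‖ ^ 2 :=
  Real.sq_sqrt (by positivity)
lemma abs_le_qnorm {m : ℕ} (z : EE m × ℝ) : |z.2| ≤ qnorm z := by
  apply Real.le_sqrt_of_sq_le; rw [sq_abs]; nlinarith [sq_nonneg ‖z.1‖]
lemma qnorm_add_nonneg {m : ℕ} (z : EE m × ℝ) : 0 ≤ qnorm z + z.2 := by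
  have := abs_le_qnorm z; have := neg_abs_le z.2; linarith
lemma qnorm_sub_nonneg {m : ℕ} (z : EE m × ℝ) : 0 ≤ qnorm z - z.2 := by
  have := abs_le_qnorm z; have := le_abs_self z.2; linarith
lemma qnorm_smul {m : ℕ} (z : EE m × ℝ) (s : ℝ) (hs : 0 ≤ s) : qnorm (s • z) = s * qnorm z := by
  rw [← sq_eq_sq₀ (qnorm_nonneg _) (mul_nonneg hs (qnorm_nonneg _)), qnorm_sq, mul_pow, qnorm_sq]
  simp [norm_smul, mul_pow]; ring
lemma pnorm_smul {m : ℕ} (z : EE m × EE m) (s : ℝ) (hs : 0 ≤ s) :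
    pnorm (s • z) = s * pnorm z := by
  rw [← sq_eq_sq₀ (pnorm_nonneg _) (mul_nonneg hs (pnorm_nonneg _)), pnorm_sq, mul_pow, pnorm_sq]
  simp [norm_smul, mul_pow]; ring
lemma qnorm_cont {m : ℕ} : Continuous (qnorm : EE m × ℝ → ℝ) := by
  unfold qnorm; fun_prop
lemma pnorm_cont {m : ℕ} : Continuous (pnorm : EE m × EE m → ℝ) := by
  unfold pnorm; fun_prop
lemma Ann_open (m : ℕ) (a b : ℝ) : IsOpen (Ann m a b) :=
  (isOpen_lt continuous_const pnorm_cont).inter (isOpen_lt pnorm_cont continuous_const)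
lemma AnnD_open (m : ℕ) (a b : ℝ) : IsOpen (AnnD m a b) :=
  (isOpen_lt continuous_const qnorm_cont).inter (isOpen_lt qnorm_cont continuous_const)

/-- the reduction map -/
def Phi {m : ℕ} (e : EE m) (z : EE m × ℝ) : EE m × EE m :=
  (Real.sqrt (qnorm z + z.2) • e, Real.sqrt (qnorm z - z.2) • e)

lemma Phi_smul {m : ℕ} (e : EE m) (z : EE m × ℝ) (s : ℝ) (hs : 0 ≤ s) :
    Phi e (s ^ 2 • z) = s • Phi e z := by
  unfold Phi
  rw [qnorm_smul _ _ (by positivity)]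
  have h1 : s ^ 2 * qnorm z + (s ^ 2 • z).2 = s ^ 2 * (qnorm z + z.2) := by simp; ring
  have h2 : s ^ 2 * qnorm z - (s ^ 2 • z).2 = s ^ 2 * (qnorm z - z.2) := by simp; ring
  rw [h1, h2, Real.sqrt_mul (by positivity), Real.sqrt_mul (by positivity), Real.sqrt_sq hs]
  simp [smul_smul]

lemma Phi_norms {m : ℕ} (e : EE m) (he : ‖e‖ = 1) (z : EE m × ℝ) :
    ‖(Phi e z).1‖ = Real.sqrt (qnorm z + z.2) ∧ ‖(Phi e z).2‖ = Real.sqrt (qnorm z - z.2) := by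
  simp [Phi, norm_smul, he, abs_of_nonneg (Real.sqrt_nonneg _)]

lemma Phi_pnorm {m : ℕ} (e : EE m) (he : ‖e‖ = 1) (z : EE m × ℝ) :
    pnorm (Phi e z) ^ 2 = 2 * qnorm z := by
  obtain ⟨h1, h2⟩ := Phi_norms e he z
  rw [pnorm_sq, h1, h2, Real.sq_sqrt (qnorm_add_nonneg z), Real.sq_sqrt (qnorm_sub_nonneg z)]
  ring

lemma Phi_mem {m : ℕ} {a b : ℝ} (ha : 0 < a) (hab : a < b) (x : EE m × EE m) (z : EE m × ℝ)
    (h : pnorm x ^ 2 = 2 * qnorm z) : x ∈ Ann m a b ↔ z ∈ AnnD m a b := by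
  have hp := pnorm_nonneg x
  simp only [Ann, AnnD, Set.mem_ofPred_eq]
  constructor
  · rintro ⟨h1, h2⟩
    constructor <;> nlinarith
  · rintro ⟨h1, h2⟩
    constructor
    · exact lt_of_pow_lt_pow_left₀ 2 hp (by linarith)
    · exact lt_of_pow_lt_pow_left₀ 2 (by linarith) (by linarith)

lemma neumann (m : ℕ) (a b : ℝ) (ha : 0 < a) (hab : a < b)
    (u : EE m × EE m → ℝ) (e : EE m) (he : ‖e‖ = 1)
    (hreg : ContDiffOn ℝ 2 u (closure (Ann m a b)))
    (hbd : ∀ x ∈ frontier (Ann m a b),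
      fderivWithin ℝ u (closure (Ann m a b)) x ((pnorm x)⁻¹ • x) = 0)
    (z : EE m × ℝ) (hz : z ∈ frontier (AnnD m a b)) :
    fderivWithin ℝ (fun z => u (Phi e z)) (closure (AnnD m a b)) z ((qnorm z)⁻¹ • z) = 0 := by
  by_cases hd : DifferentiableWithinAt ℝ (fun z => u (Phi e z)) (closure (AnnD m a b)) z
  swap
  · rw [fderivWithin_zero_of_not_differentiableWithinAt hd]; simp
  have hcl : z ∈ {z : EE m × ℝ | a ^ 2 / 2 ≤ qnorm z ∧ qnorm z ≤ b ^ 2 / 2} := by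
    refine closure_minimal (fun y hy => ?_) ?_ hz.1
    · exact ⟨hy.1.le, hy.2.le⟩
    · exact (isClosed_le continuous_const qnorm_cont).inter
        (isClosed_le qnorm_cont continuous_const)
  have hnot : z ∉ AnnD m a b := by
    have := hz.2; rwa [(AnnD_open m a b).interior_eq] at this
  set x := Phi e z with hx
  have hpq : pnorm x ^ 2 = 2 * qnorm z := Phi_pnorm e he z
  have hp0 := pnorm_nonneg x
  obtain ⟨hq1, hq2⟩ := hcl
  have hpa : a ≤ pnorm x := by nlinarith
  have hpb : pnorm x ≤ b := by nlinarith
  have hp : 0 < pnorm x := by linarith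
  let S := Set.Ioo (a / pnorm x) (b / pnorm x)
  have hne : a / pnorm x < b / pnorm x := by gcongr
  have hclS : (1:ℝ) ∈ closure S := by
    rw [closure_Ioo hne.ne]
    exact ⟨(div_le_one hp).2 hpa, (one_le_div hp).2 hpb⟩
  have hpos : ∀ s ∈ S, 0 < s := fun s hs => lt_trans (by positivity) hs.1
  have hSA : ∀ s ∈ S, s • x ∈ Ann m a b := fun s hs => by
    have h0 := hpos s hs
    simp only [Ann, Set.mem_ofPred_eq, pnorm_smul x s h0.le]
    exact ⟨(div_lt_iff₀ hp).1 hs.1, (lt_div_iff₀ hp).1 hs.2⟩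
  have hSD : ∀ s ∈ S, s ^ 2 • z ∈ AnnD m a b := fun s hs => by
    have h0 := hpos s hs
    rw [← Phi_mem ha hab (Phi e (s ^ 2 • z)) _ (Phi_pnorm e he _), Phi_smul e z s h0.le]
    exact hSA s hs
  have hU : UniqueDiffWithinAt ℝ S 1 :=
    uniqueDiffWithinAt_convex (convex_Ioo _ _) (by simpa [S] using hne) hclS
  have hxcl : x ∈ closure (Ann m a b) := by
    have : (1:ℝ) • x ∈ closure (Ann m a b) := by
      refine map_mem_closure (f := fun s : ℝ => s • x) (by fun_prop) hclS hSA
    simpa using this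
  have hxfr : x ∈ frontier (Ann m a b) := by
    refine ⟨hxcl, ?_⟩
    rw [(Ann_open m a b).interior_eq, Phi_mem ha hab x z hpq]; exact hnot
  have h0 := hbd x hxfr
  rw [map_smul, smul_eq_zero] at h0
  have h0 : fderivWithin ℝ u (closure (Ann m a b)) x x = 0 := by
    rcases h0 with h | h
    · exact absurd h (by positivity)
    · exact h
  have hu := ((hreg x hxcl).differentiableWithinAt (by simp)).hasFDerivWithinAt
  have d1 : HasDerivWithinAt (fun s : ℝ => u (s • x)) 0 S 1 := by
    have hc : HasDerivWithinAt (fun s : ℝ => s • x) x S 1 := by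
      simpa using ((hasDerivAt_id (1:ℝ)).smul_const x).hasDerivWithinAt
    have := HasFDerivWithinAt.comp_hasDerivWithinAt (l := u) (1:ℝ) (f := fun s : ℝ => s • x)
      (t := closure (Ann m a b)) (by simpa using hu) hc (fun s hs => subset_closure (hSA s hs))
    rw [h0] at this
    exact this
  have d2 : HasDerivWithinAt (fun s : ℝ => u (Phi e (s ^ 2 • z)))
      (fderivWithin ℝ (fun z => u (Phi e z)) (closure (AnnD m a b)) z ((2:ℝ) • z)) S 1 := by
    have hc : HasDerivWithinAt (fun s : ℝ => s ^ 2 • z) ((2:ℝ) • z) S 1 := by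
      simpa using (((hasDerivAt_id (1:ℝ)).pow 2).smul_const z).hasDerivWithinAt
    exact HasFDerivWithinAt.comp_hasDerivWithinAt (l := fun z => u (Phi e z)) (1:ℝ)
      (f := fun s : ℝ => s ^ 2 • z)
      (t := closure (AnnD m a b)) (by simpa using hd.hasFDerivWithinAt) hc
      (fun s hs => subset_closure (hSD s hs))
  have d3 : HasDerivWithinAt (fun s : ℝ => u (Phi e (s ^ 2 • z))) 0 S 1 := by
    refine d1.congr (fun s hs => ?_) ?_
    · rw [Phi_smul e z s (hpos s hs).le]
    · rw [Phi_smul e z 1 (by norm_num)]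
  have := hU.eq_deriv _ d2 d3
  rw [map_smul, smul_eq_zero] at this
  have := this.resolve_left (by norm_num)
  rw [map_smul, this, smul_zero]

lemma rot_norm {m : ℕ} (p : EE m) (i j : Fin m) (hij : i ≠ j) (α β : ℝ)
    (h : (1 + α) ^ 2 + β ^ 2 = 1) :
    ‖p + α • (p i • EuclideanSpace.single i (1:ℝ) + p j • EuclideanSpace.single j (1:ℝ))
      + β • (-(p j) • EuclideanSpace.single i (1:ℝ) + p i • EuclideanSpace.single j (1:ℝ))‖ = ‖p‖ := by
  rw [← sq_eq_sq₀ (norm_nonneg _) (norm_nonneg _), ← real_inner_self_eq_norm_sq,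
    ← real_inner_self_eq_norm_sq]
  simp only [inner_add_left, inner_add_right, inner_smul_left, inner_smul_right,
    EuclideanSpace.inner_single_left, EuclideanSpace.inner_single_right]
  simp [hij, hij.symm]
  linear_combination ((p i) ^ 2 + (p j) ^ 2) * h

lemma sum_single {m : ℕ} (p : EE m) : p = ∑ i, p i • EuclideanSpace.single i (1:ℝ) := by
  ext j
  simp [Finset.sum_apply, Pi.single_apply]

lemma norm_sq_sum {m : ℕ} (p : EE m) : ‖p‖ ^ 2 = ∑ i, p i ^ 2 := by
  rw [EuclideanSpace.norm_sq_eq]; simp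

lemma pair_rel {m : ℕ} (v : EE m × ℝ → ℝ) (z : EE m × ℝ) (hv : ContDiffAt ℝ 2 v z)
    (hr : ∀ z w : EE m × ℝ, ‖z.1‖ = ‖w.1‖ → z.2 = w.2 → v z = v w) (i j : Fin m) (hij : i ≠ j) :
    let J : EE m × ℝ := (-(z.1 j) • EuclideanSpace.single i (1:ℝ)
      + z.1 i • EuclideanSpace.single j (1:ℝ), 0)
    let P : EE m × ℝ := (z.1 i • EuclideanSpace.single i (1:ℝ)
      + z.1 j • EuclideanSpace.single j (1:ℝ), 0)
    fderiv ℝ (fderiv ℝ v) z J J - fderiv ℝ v z P = 0 := by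
  intro J P
  let c : ℝ → EE m × ℝ := fun s => z + (cos s - 1) • P + sin s • J
  let c' : ℝ → EE m × ℝ := fun s => (-sin s) • P + cos s • J
  have hc : ∀ s, HasDerivAt c (c' s) s := fun s => by
    have h1 := (((hasDerivAt_cos s).sub_const 1).smul_const P).const_add z
    exact h1.add ((hasDerivAt_sin s).smul_const J)
  have hc' : HasDerivAt c' (-P) 0 := by
    have h1 := ((hasDerivAt_sin 0).neg.smul_const P).add ((hasDerivAt_cos 0).smul_const J)
    have h2 : -P = -cos 0 • P + -sin 0 • J := by simp
    rw [h2]; exact h1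
  have hc0 : c 0 = z := by simp [c]
  have hc'0 : c' 0 = J := by simp [c']
  have h := chain2 v c c' (-P) (by rw [hc0]; exact hv) (Eventually.of_forall hc) hc'
  have hconst : (fun s => v (c s)) = fun _ => v z := by
    funext s
    apply hr
    · have := rot_norm z.1 i j hij (cos s - 1) (sin s) (by ring_nf; exact cos_sq_add_sin_sq s)
      simpa [c, P, J] using this
    · simp [c, P, J]
  rw [hconst, hc0, hc'0] at h
  simp at h
  linarith

lemma radial {m : ℕ} (v : EE m × ℝ → ℝ) (z : EE m × ℝ) (hv : ContDiffAt ℝ 2 v z)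
    (hr : ∀ z w : EE m × ℝ, ‖z.1‖ = ‖w.1‖ → z.2 = w.2 → v z = v w) :
    ‖z.1‖ ^ 2 * ∑ i, fderiv ℝ (fderiv ℝ v) z (EuclideanSpace.single i (1:ℝ), 0)
        (EuclideanSpace.single i (1:ℝ), 0)
      = fderiv ℝ (fderiv ℝ v) z (z.1, 0) (z.1, 0) + (m - 1) * fderiv ℝ v z (z.1, 0) := by
  set ε : Fin m → EE m × ℝ := fun i => (EuclideanSpace.single i (1:ℝ), 0) with hε
  set B := fderiv ℝ (fderiv ℝ v) z with hB
  set L := fderiv ℝ v z with hL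
  set p := z.1 with hp
  have hpe : ((p, 0) : EE m × ℝ) = ∑ i, p i • ε i := by
    apply Prod.ext
    · simp only [Prod.fst_sum, hε, Prod.smul_fst]; exact sum_single p
    · simp [Prod.snd_sum, hε]
  have hBp : B (p, 0) (p, 0) = ∑ i, ∑ j, p i * p j * B (ε i) (ε j) := by
    rw [hpe]
    simp only [map_sum, map_smul, _root_.sum_apply, _root_.smul_apply,
      smul_eq_mul, Finset.mul_sum]
    rw [Finset.sum_comm]
    refine Finset.sum_congr rfl fun i _ => Finset.sum_congr rfl fun j _ => by ring
  have hLp : L (p, 0) = ∑ i, p i * L (ε i) := by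
    rw [hpe]; simp
  have hT : ∀ i j, p j ^ 2 * B (ε i) (ε i) + p i ^ 2 * B (ε j) (ε j) - p i * p j * B (ε i) (ε j)
      - p i * p j * B (ε j) (ε i) - p i * L (ε i) - p j * L (ε j)
      = if i = j then - 2 * (p i * L (ε i)) else 0 := by
    intro i j
    split_ifs with hij
    · subst hij; ring
    · have h := pair_rel v z hv hr i j hij
      have hJ : ((-(p j) • EuclideanSpace.single i (1:ℝ)
        + p i • EuclideanSpace.single j (1:ℝ), 0) : EE m × ℝ) = -(p j) • ε i + p i • ε j := by
        simp [hε]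
      have hP : ((p i • EuclideanSpace.single i (1:ℝ)
        + p j • EuclideanSpace.single j (1:ℝ), 0) : EE m × ℝ) = p i • ε i + p j • ε j := by
        simp [hε]
      simp only [← hp, ← hB, ← hL] at h
      rw [hJ, hP] at h
      simp only [map_add, map_smul, _root_.add_apply, _root_.smul_apply,
        smul_eq_mul] at h
      linear_combination h
  have hsum := Finset.sum_congr rfl (fun i (_ : i ∈ Finset.univ) =>
    Finset.sum_congr rfl (fun j (_ : j ∈ Finset.univ) => hT i j))
  have hsw : ∑ i, ∑ j, p i * p j * B (ε j) (ε i) = ∑ i, ∑ j, p i * p j * B (ε i) (ε j) := by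
    rw [Finset.sum_comm]
    refine Finset.sum_congr rfl fun i _ => Finset.sum_congr rfl fun j _ => by ring
  simp only [Finset.sum_sub_distrib, Finset.sum_add_distrib, Finset.sum_ite_eq, Finset.mem_univ,
    if_true, ← Finset.sum_mul, ← Finset.mul_sum, ← norm_sq_sum, Finset.sum_const,
    Finset.card_univ, Fintype.card_fin, nsmul_eq_mul, ← hLp] at hsum
  have e1 : ∑ i, ∑ j, p i * p j * B (ε i) (ε j) = B (p, 0) (p, 0) := hBp.symm
  simp only [mul_assoc, ← Finset.mul_sum] at hsum hsw e1
  rw [hsw, e1, ← hLp] at hsum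
  linear_combination hsum / 2

/-- the smooth form of the reduction map off the negative axis -/
def Phi1 {m : ℕ} (e : EE m) (z : EE m × ℝ) : EE m × EE m :=
  (Real.sqrt (qnorm z + z.2) • e, (Real.sqrt (qnorm z + z.2))⁻¹ • z.1)

lemma Phi1_norms {m : ℕ} (e : EE m) (z : EE m × ℝ) (hz : 0 < qnorm z + z.2) :
    ‖(Phi e z).1‖ = ‖(Phi1 e z).1‖ ∧ ‖(Phi1 e z).2‖ = Real.sqrt (qnorm z - z.2) := by
  refine ⟨rfl, ?_⟩
  have h1 : ‖z.1‖ ^ 2 = (qnorm z + z.2) * (qnorm z - z.2) := by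
    have := qnorm_sq z; linear_combination -this
  have h2 : ‖z.1‖ = Real.sqrt (qnorm z + z.2) * Real.sqrt (qnorm z - z.2) := by
    rw [← Real.sqrt_mul hz.le, ← h1, Real.sqrt_sq (norm_nonneg _)]
  have h3 : 0 < Real.sqrt (qnorm z + z.2) := Real.sqrt_pos.2 hz
  simp only [Phi1, norm_smul, norm_inv, Real.norm_eq_abs, abs_of_pos h3]
  rw [h2]; field_simp

lemma qnorm_contDiffAt {m : ℕ} (z : EE m × ℝ) (hz : 0 < qnorm z) :
    ContDiffAt ℝ 2 (qnorm : EE m × ℝ → ℝ) z := by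
  unfold qnorm
  refine ContDiffAt.sqrt ?_ ?_
  · exact (contDiff_fst.norm_sq ℝ).contDiffAt.add (contDiff_snd.pow 2).contDiffAt
  · intro h
    have := qnorm_sq z
    rw [h] at this
    nlinarith

lemma Phi1_contDiffAt {m : ℕ} (e : EE m) (z : EE m × ℝ) (hq : 0 < qnorm z)
    (hz : 0 < qnorm z + z.2) : ContDiffAt ℝ 2 (Phi1 e) z := by
  have h1 : ContDiffAt ℝ 2 (fun z : EE m × ℝ => Real.sqrt (qnorm z + z.2)) z :=
    ((qnorm_contDiffAt z hq).add contDiff_snd.contDiffAt).sqrt hz.ne'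
  unfold Phi1
  exact (h1.smul contDiffAt_const).prodMk
    ((h1.inv (Real.sqrt_pos.2 hz).ne').smul contDiff_fst.contDiffAt)

/-- Inverse map. -/
def Psi {m : ℕ} (y : EE m × EE m) : EE m × ℝ := (‖y.1‖ • y.2, (‖y.1‖ ^ 2 - ‖y.2‖ ^ 2) / 2)

lemma Psi_qnorm {m : ℕ} (y : EE m × EE m) : qnorm (Psi y) = (‖y.1‖ ^ 2 + ‖y.2‖ ^ 2) / 2 := by
  rw [← sq_eq_sq₀ (qnorm_nonneg _) (by positivity), qnorm_sq]
  simp only [Psi, norm_smul, norm_norm]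
  ring

lemma Phi_Psi_norms {m : ℕ} (e : EE m) (he : ‖e‖ = 1) (y : EE m × EE m) :
    ‖(Phi e (Psi y)).1‖ = ‖y.1‖ ∧ ‖(Phi e (Psi y)).2‖ = ‖y.2‖ := by
  obtain ⟨h1, h2⟩ := Phi_norms e he (Psi y)
  rw [h1, h2, Psi_qnorm]
  constructor
  · rw [show (‖y.1‖ ^ 2 + ‖y.2‖ ^ 2) / 2 + (Psi y).2 = ‖y.1‖ ^ 2 by simp [Psi]; ring,
      Real.sqrt_sq (norm_nonneg _)]
  · rw [show (‖y.1‖ ^ 2 + ‖y.2‖ ^ 2) / 2 - (Psi y).2 = ‖y.2‖ ^ 2 by simp [Psi]; ring,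
      Real.sqrt_sq (norm_nonneg _)]

lemma Ann_of_norms {m : ℕ} {a b : ℝ} {x y : EE m × EE m} (h1 : ‖x.1‖ = ‖y.1‖)
    (h2 : ‖x.2‖ = ‖y.2‖) (h : x ∈ Ann m a b) : y ∈ Ann m a b := by
  simpa only [Ann, Set.mem_ofPred_eq, pnorm, h1, h2] using h

lemma Psi_Phi1 {m : ℕ} (e : EE m) (he : ‖e‖ = 1) (z : EE m × ℝ) (hz : 0 < qnorm z + z.2) :
    Psi (Phi1 e z) = z := by
  obtain ⟨h1, h2⟩ := Phi1_norms e z hz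
  have h3 := (Phi_norms e he z).1
  rw [h1] at h3
  unfold Psi
  rw [h3, h2, Real.sq_sqrt hz.le, Real.sq_sqrt (qnorm_sub_nonneg z)]
  apply Prod.ext
  · simp only [Phi1]
    rw [smul_smul, mul_inv_cancel₀ (Real.sqrt_pos.2 hz).ne', one_smul]
  · simp only []; ring

lemma line1 {m : ℕ} (r : ℝ) (hr : 0 < r) (i0 i : Fin m) (y2 : EE m) (v : EE m × ℝ → ℝ)
    (z : EE m × ℝ) (hz : Psi (r • EuclideanSpace.single i0 (1:ℝ), y2) = z)
    (hv : ContDiffAt ℝ 2 v z) :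
    deriv (deriv (fun s : ℝ => v (Psi ((r • EuclideanSpace.single i0 (1:ℝ), y2)
        + s • (EuclideanSpace.single i (1:ℝ), 0))))) 0
      = if i = i0 then fderiv ℝ (fderiv ℝ v) z (y2, r) (y2, r) + fderiv ℝ v z (0, 1)
        else fderiv ℝ v z (r⁻¹ • y2, 1) := by
  set k : ℝ := if i = i0 then r else 0 with hk
  set N : ℝ → ℝ := fun s => r ^ 2 + 2 * s * k + s ^ 2 with hN
  have hN0 : N 0 = r ^ 2 := by simp [hN]
  have hsq : Real.sqrt (r ^ 2) = r := Real.sqrt_sq hr.le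
  have hnorm : ∀ s : ℝ, ‖r • EuclideanSpace.single i0 (1:ℝ) + s • EuclideanSpace.single i (1:ℝ)‖ ^ 2
      = N s := by
    intro s
    rw [← real_inner_self_eq_norm_sq]
    simp only [inner_add_left, inner_add_right, inner_smul_left, inner_smul_right,
      EuclideanSpace.inner_single_left, EuclideanSpace.inner_single_right]
    by_cases h : i = i0
    · subst h; simp [hN, hk]; ring
    · simp [hN, hk, h, Ne.symm h]; ring
  have hNn : ∀ s, 0 ≤ N s := fun s => by rw [← hnorm]; positivity
  have hnorm' : ∀ s : ℝ, ‖r • EuclideanSpace.single i0 (1:ℝ) + s • EuclideanSpace.single i (1:ℝ)‖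
      = Real.sqrt (N s) := fun s => by rw [← hnorm, Real.sqrt_sq (norm_nonneg _)]
  let c : ℝ → EE m × ℝ := fun s => (Real.sqrt (N s) • y2, (N s - ‖y2‖ ^ 2) / 2)
  let c' : ℝ → EE m × ℝ := fun s => (((k + s) / Real.sqrt (N s)) • y2, k + s)
  have hcc : (fun s : ℝ => v (Psi ((r • EuclideanSpace.single i0 (1:ℝ), y2)
        + s • (EuclideanSpace.single i (1:ℝ), 0)))) = fun s => v (c s) := by
    funext s
    congr 1
    simp only [Psi, Prod.fst_add, Prod.snd_add, Prod.smul_fst, Prod.smul_snd, smul_zero, add_zero,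
      hnorm', c, Real.sq_sqrt (hNn s)]
  have hNd : ∀ s, HasDerivAt N (2 * (k + s)) s := fun s => by
    have h1 := ((((hasDerivAt_id s).const_mul 2).mul_const k).const_add (r ^ 2)).add
      ((hasDerivAt_id s).pow 2)
    refine h1.congr_deriv ?_
    simp; ring
  have hsd : ∀ s, N s ≠ 0 → HasDerivAt (fun s => Real.sqrt (N s)) ((k + s) / Real.sqrt (N s)) s :=
    fun s hs => by
      convert (hNd s).sqrt hs using 1
      field_simp
  have hne : ∀ᶠ s in 𝓝 (0:ℝ), N s ≠ 0 :=
    (hNd 0).continuousAt.eventually_ne (by rw [hN0]; positivity)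
  have hc : ∀ᶠ s in 𝓝 (0:ℝ), HasDerivAt c (c' s) s := by
    filter_upwards [hne] with s hs
    refine ((hsd s hs).smul_const y2).prodMk ?_
    refine (((hNd s).sub_const (‖y2‖ ^ 2)).div_const 2).congr_deriv ?_
    ring
  have hc' : HasDerivAt c' ((r⁻¹ - k ^ 2 / r ^ 3) • y2, 1) 0 := by
    have hid : HasDerivAt (fun s : ℝ => k + s) 1 0 := (hasDerivAt_id (0:ℝ)).const_add k
    refine HasDerivAt.prodMk ?_ hid
    refine HasDerivAt.smul_const ?_ y2
    have := hid.div (hsd 0 hne.self_of_nhds) (by rw [hN0, hsq]; exact hr.ne')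
    refine this.congr_deriv ?_
    rw [hN0, hsq]
    field_simp
    ring
  have hc0 : c 0 = z := by
    rw [← hz]
    simp [c, Psi, hN0, hsq, norm_smul, abs_of_pos hr]
  rw [hcc, chain2 v c c' _ (by rw [hc0]; exact hv) hc hc', hc0]
  have hc'0 : c' 0 = ((k / r) • y2, k) := by simp [c', hN0, hsq]
  rw [hc'0]
  split_ifs with h
  · have : k = r := by simp [hk, h]
    rw [this]
    have h1 : r / r = 1 := div_self hr.ne'
    have h2 : r⁻¹ - r ^ 2 / r ^ 3 = 0 := by field_simp; ring
    rw [h1, h2, one_smul, zero_smul]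
  · have : k = 0 := by simp [hk, h]
    rw [this]
    have : (((0:ℝ) / r) • y2, (0:ℝ)) = 0 := by simp
    rw [this]
    simp

lemma line2 {m : ℕ} (r : ℝ) (hr : 0 < r) (i0 i : Fin m) (y2 : EE m) (v : EE m × ℝ → ℝ)
    (z : EE m × ℝ) (hz : Psi (r • EuclideanSpace.single i0 (1:ℝ), y2) = z)
    (hv : ContDiffAt ℝ 2 v z) :
    deriv (deriv (fun s : ℝ => v (Psi ((r • EuclideanSpace.single i0 (1:ℝ), y2)
        + s • (0, EuclideanSpace.single i (1:ℝ)))))) 0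
      = fderiv ℝ (fderiv ℝ v) z (r • EuclideanSpace.single i (1:ℝ), -y2 i)
          (r • EuclideanSpace.single i (1:ℝ), -y2 i) + fderiv ℝ v z (0, -1) := by
  have hnorm : ∀ s : ℝ, ‖y2 + s • EuclideanSpace.single i (1:ℝ)‖ ^ 2
      = ‖y2‖ ^ 2 + 2 * s * y2 i + s ^ 2 := by
    intro s
    rw [← real_inner_self_eq_norm_sq, ← real_inner_self_eq_norm_sq]
    simp only [inner_add_left, inner_add_right, inner_smul_left, inner_smul_right,
      EuclideanSpace.inner_single_left, EuclideanSpace.inner_single_right]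
    simp; ring
  let c : ℝ → EE m × ℝ := fun s => (r • (y2 + s • EuclideanSpace.single i (1:ℝ)),
    (r ^ 2 - (‖y2‖ ^ 2 + 2 * s * y2 i + s ^ 2)) / 2)
  let c' : ℝ → EE m × ℝ := fun s => (r • EuclideanSpace.single i (1:ℝ), -y2 i - s)
  have hcc : (fun s : ℝ => v (Psi ((r • EuclideanSpace.single i0 (1:ℝ), y2)
        + s • (0, EuclideanSpace.single i (1:ℝ))))) = fun s => v (c s) := by
    funext s
    congr 1
    simp only [Psi, Prod.fst_add, Prod.snd_add, Prod.smul_fst, Prod.smul_snd, smul_zero, add_zero,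
      hnorm, c]
    simp [norm_smul, abs_of_pos hr]
  have hc : ∀ s, HasDerivAt c (c' s) s := fun s => by
    refine HasDerivAt.prodMk ?_ ?_
    · have := (((hasDerivAt_id s).smul_const (EuclideanSpace.single i (1:ℝ))).const_add y2).const_smul r
      rw [one_smul] at this
      exact this
    · have h1 := (((((hasDerivAt_id s).const_mul 2).mul_const (y2 i)).const_add (‖y2‖ ^ 2)).add
        ((hasDerivAt_id s).pow 2)).const_sub (r ^ 2) |>.div_const 2
      refine h1.congr_deriv ?_
      simp; ring
  have hc' : HasDerivAt c' (0, -1) 0 := by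
    refine HasDerivAt.prodMk (hasDerivAt_const _ _) ?_
    exact (hasDerivAt_id (0:ℝ)).const_sub (-y2 i)
  have hc0 : c 0 = z := by
    rw [← hz]
    simp [c, Psi, norm_smul, abs_of_pos hr]
  rw [hcc, chain2 v c c' _ (by rw [hc0]; exact hv) (Eventually.of_forall hc) hc', hc0]
  simp [c']

lemma core (m : ℕ) (i0 : Fin m) (a b : ℝ) (ha : 0 < a) (hab : a < b) (f : ℝ → ℝ)
    (u : EE m × EE m → ℝ) (hreg : ContDiffOn ℝ 2 u (Ann m a b))
    (hinv : ∀ x ∈ Ann m a b, ∀ x' ∈ Ann m a b, ‖x.1‖ = ‖x'.1‖ → ‖x.2‖ = ‖x'.2‖ → u x = u x')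
    (heq : ∀ x ∈ Ann m a b, -lapP u x = f (u x))
    (z : EE m × ℝ) (hz : z ∈ AnnD m a b) (hpos : 0 < qnorm z + z.2) :
    ContDiffAt ℝ 2 (fun z => u (Phi (EuclideanSpace.single i0 (1:ℝ)) z)) z ∧
    -lapQ (fun z => u (Phi (EuclideanSpace.single i0 (1:ℝ)) z)) z
      = f (u (Phi (EuclideanSpace.single i0 (1:ℝ)) z)) / (2 * qnorm z) := by
  set e : EE m := EuclideanSpace.single i0 (1:ℝ) with he'
  have he : ‖e‖ = 1 := by simp [he']
  set v : EE m × ℝ → ℝ := fun z => u (Phi e z) with hv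
  have hq : 0 < qnorm z := lt_trans (by positivity) hz.1
  have hPhiA : ∀ w ∈ AnnD m a b, Phi e w ∈ Ann m a b := fun w hw =>
    (Phi_mem ha hab _ _ (Phi_pnorm e he w)).2 hw
  have hPhi1A : ∀ w ∈ AnnD m a b, 0 < qnorm w + w.2 → Phi1 e w ∈ Ann m a b := fun w hw h =>
    Ann_of_norms (Phi1_norms e w h).1 ((Phi_norms e he w).2.trans (Phi1_norms e w h).2.symm)
      (hPhiA w hw)
  have hv1 : ∀ w ∈ AnnD m a b, 0 < qnorm w + w.2 → v w = u (Phi1 e w) := fun w hw h =>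
    hinv _ (hPhiA w hw) _ (hPhi1A w hw h) (Phi1_norms e w h).1
      ((Phi_norms e he w).2.trans (Phi1_norms e w h).2.symm)
  set y := Phi1 e z with hy
  have hyA : y ∈ Ann m a b := hPhi1A z hz hpos
  have huy : ContDiffAt ℝ 2 u y := hreg.contDiffAt ((Ann_open m a b).mem_nhds hyA)
  have hvc : ContDiffAt ℝ 2 v z := by
    have h1 : ContDiffAt ℝ 2 (fun w => u (Phi1 e w)) z :=
      ContDiffAt.comp z huy (Phi1_contDiffAt e z hq hpos)
    refine h1.congr_of_eventuallyEq ?_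
    have hop : IsOpen {w : EE m × ℝ | 0 < qnorm w + w.2} :=
      isOpen_lt continuous_const (qnorm_cont.add continuous_snd)
    filter_upwards [(AnnD_open m a b).mem_nhds hz, hop.mem_nhds hpos] with w h1 h2
    exact hv1 w h1 h2
  refine ⟨hvc, ?_⟩
  -- radial symmetry
  have hsymm : ∀ z w : EE m × ℝ, ‖z.1‖ = ‖w.1‖ → z.2 = w.2 → v z = v w := by
    intro z w h1 h2
    simp only [hv, Phi, qnorm, h1, h2]
  have hrad := radial v z hvc hsymm
  have huv : ∀ x ∈ Ann m a b, u x = v (Psi x) := fun x hx =>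
    hinv _ hx _ (Ann_of_norms (Phi_Psi_norms e he x).1.symm (Phi_Psi_norms e he x).2.symm hx)
      (Phi_Psi_norms e he x).1.symm (Phi_Psi_norms e he x).2.symm
  have hline : ∀ d : EE m × EE m, fderiv ℝ (fun y => fderiv ℝ u y d) y d
      = deriv (deriv (fun s : ℝ => v (Psi (y + s • d)))) 0 := by
    intro d
    rw [hess_line u y d huy]
    apply Filter.EventuallyEq.deriv_eq
    apply Filter.EventuallyEq.deriv
    have hcont : Continuous (fun s : ℝ => y + s • d) := by fun_prop
    have : ∀ᶠ s in 𝓝 (0:ℝ), y + s • d ∈ Ann m a b :=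
      hcont.continuousAt.eventually_mem ((Ann_open m a b).mem_nhds (by simpa using hyA))
    filter_upwards [this] with s hs
    exact huv _ hs
  set r := Real.sqrt (qnorm z + z.2) with hr
  have hr0 : 0 < r := Real.sqrt_pos.2 hpos
  have hrsq : r ^ 2 = qnorm z + z.2 := Real.sq_sqrt hpos.le
  set y2 : EE m := r⁻¹ • z.1 with hy2
  have hyeq : y = (r • EuclideanSpace.single i0 (1:ℝ), y2) := rfl
  have hPz : Psi (r • EuclideanSpace.single i0 (1:ℝ), y2) = z := Psi_Phi1 e he z hpos
  have hE := heq y hyA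
  unfold lapP at hE
  simp only [hline] at hE
  rw [hyeq] at hE
  simp only [line1 r hr0 i0 _ y2 v z hPz hvc, line2 r hr0 i0 _ y2 v z hPz hvc] at hE
  rw [← hyeq] at hE
  have huz : u y = v z := (hv1 z hz hpos).symm
  have hgoal : lapQ v z = ∑ i, fderiv ℝ (fderiv ℝ v) z (EuclideanSpace.single i (1:ℝ), 0)
      (EuclideanSpace.single i (1:ℝ), 0) + fderiv ℝ (fderiv ℝ v) z (0, 1) (0, 1) := by
    unfold lapQ
    simp only [hess_apply v z _ _ hvc]
  change -lapQ v z = f (v z) / (2 * qnorm z)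
  rw [hgoal, ← huz, ← hE]
  set ε : Fin m → EE m × ℝ := fun i => (EuclideanSpace.single i (1:ℝ), 0) with hε
  set τ : EE m × ℝ := (0, 1) with hτ
  set B := fderiv ℝ (fderiv ℝ v) z with hB
  set L := fderiv ℝ v z with hL
  set ζ : EE m × ℝ := (z.1, 0) with hζ
  have d1 : ((y2, r) : EE m × ℝ) = r⁻¹ • ζ + r • τ := by simp [hζ, hτ, hy2]
  have d2 : ((r⁻¹ • y2, 1) : EE m × ℝ) = (r⁻¹ ^ 2) • ζ + τ := by
    simp [hζ, hτ, hy2, smul_smul, sq]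
  have d3 : ∀ i, ((r • EuclideanSpace.single i (1:ℝ), -y2 i) : EE m × ℝ)
      = r • ε i + (-(r⁻¹ * z.1 i)) • τ := fun i => by simp [hε, hτ, hy2]
  have d4 : ((0, -1) : EE m × ℝ) = -τ := by simp [hτ]
  have hζs : ζ = ∑ i, z.1 i • ε i := by
    apply Prod.ext
    · simp only [Prod.fst_sum, hε, hζ, Prod.smul_fst]; exact sum_single z.1
    · simp [Prod.snd_sum, hε, hζ]
  have c1 : ∑ i, z.1 i * B (ε i) τ = B ζ τ := by
    rw [hζs]; simp [_root_.sum_apply]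
  have c2 : ∑ i, z.1 i * B τ (ε i) = B τ ζ := by
    rw [hζs]; simp
  have c3 : ∑ i, z.1 i ^ 2 = ‖z.1‖ ^ 2 := (norm_sq_sum _).symm
  have s1 : ∑ i : Fin m, (if i = i0 then B (y2, r) (y2, r) + L τ else L (r⁻¹ • y2, 1))
      = B (y2, r) (y2, r) + L τ + (m - 1) * L (r⁻¹ • y2, 1) := by
    rw [← Finset.add_sum_erase _ _ (Finset.mem_univ i0)]
    rw [Finset.sum_congr rfl (g := fun _ => L (r⁻¹ • y2, 1))
      (fun i hi => if_neg (Finset.ne_of_mem_erase hi))]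
    have hm1 : 1 ≤ m := Nat.one_le_iff_ne_zero.2 (fun h => by subst h; exact i0.elim0)
    simp [Finset.card_erase_of_mem, Nat.cast_sub hm1]
  have s2 : ∑ i : Fin m, (B (r • EuclideanSpace.single i (1:ℝ), -y2 i)
          (r • EuclideanSpace.single i (1:ℝ), -y2 i) + L (0, -1))
      = r ^ 2 * ∑ i, B (ε i) (ε i) - B ζ τ - B τ ζ + r⁻¹ ^ 2 * ‖z.1‖ ^ 2 * B τ τ - m * L τ := by
    have : ∀ i : Fin m, (B (r • EuclideanSpace.single i (1:ℝ), -y2 i)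
          (r • EuclideanSpace.single i (1:ℝ), -y2 i) + L (0, -1))
        = r ^ 2 * B (ε i) (ε i) - z.1 i * B (ε i) τ - z.1 i * B τ (ε i)
          + r⁻¹ ^ 2 * B τ τ * z.1 i ^ 2 - L τ := by
      intro i
      rw [d3, d4]
      simp only [map_add, map_smul, _root_.add_apply, _root_.smul_apply, smul_eq_mul, map_neg]
      field_simp
      ring
    simp only [this, Finset.sum_sub_distrib, Finset.sum_add_distrib, ← Finset.mul_sum, c1, c2, c3]
    simp
    ring
  rw [s1, s2, d1, d2]
  simp only [map_add, map_smul, _root_.add_apply, _root_.smul_apply, smul_eq_mul]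
  have hn : ‖z.1‖ ^ 2 = r ^ 2 * (2 * qnorm z - r ^ 2) := by
    rw [hrsq]
    have := qnorm_sq z; linear_combination -this
  rw [hn] at hrad ⊢
  rw [eq_div_iff (by positivity)]
  have hrad2 : B ζ ζ = r ^ 2 * (2 * qnorm z - r ^ 2) * ∑ i, B (ε i) (ε i) - (m - 1) * L ζ := by
    linear_combination -hrad
  rw [hrad2]
  field_simp
  ring

lemma fderiv2_swap {E F : Type*} [NormedAddCommGroup E] [NormedSpace ℝ E] [NormedAddCommGroup F]
    [NormedSpace ℝ F] (σ : E ≃L[ℝ] F) (g : F → ℝ) (x e : E) :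
    fderiv ℝ (fun y => fderiv ℝ (fun w => g (σ w)) y e) x e
      = fderiv ℝ (fun y => fderiv ℝ g y (σ e)) (σ x) (σ e) := by
  have h1 : (fun y => fderiv ℝ (fun w => g (σ w)) y e) = fun y => fderiv ℝ g (σ y) (σ e) := by
    funext y
    have := σ.comp_right_fderiv (f := g) (x := y)
    change fderiv ℝ (g ∘ σ) y e = _
    rw [this]; rfl
  rw [h1]
  have := σ.comp_right_fderiv (f := fun y => fderiv ℝ g y (σ e)) (x := x)
  change fderiv ℝ ((fun y => fderiv ℝ g y (σ e)) ∘ σ) x e = _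
  rw [this]; rfl

/-- swap of the two factors -/
def sw (m : ℕ) : (EE m × EE m) ≃L[ℝ] (EE m × EE m) := ContinuousLinearEquiv.prodComm ℝ (EE m) (EE m)

/-- reflection of the last coordinate -/
def rf (m : ℕ) : (EE m × ℝ) ≃L[ℝ] (EE m × ℝ) :=
  (ContinuousLinearEquiv.refl ℝ (EE m)).prodCongr (ContinuousLinearEquiv.neg ℝ)

lemma sw_apply {m : ℕ} (x : EE m × EE m) : sw m x = (x.2, x.1) := rfl
lemma rf_apply {m : ℕ} (x : EE m × ℝ) : rf m x = (x.1, -x.2) := rfl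

lemma lapP_swap {m : ℕ} (u : EE m × EE m → ℝ) (x : EE m × EE m) :
    lapP (fun y => u (sw m y)) x = lapP u (sw m x) := by
  unfold lapP
  simp only [fderiv2_swap]
  rw [add_comm]
  rfl

lemma lapQ_refl {m : ℕ} (v : EE m × ℝ → ℝ) (z : EE m × ℝ) :
    lapQ (fun y => v (rf m y)) z = lapQ v (rf m z) := by
  unfold lapQ
  simp only [fderiv2_swap]
  have h1 : ∀ i, rf m (EuclideanSpace.single i (1:ℝ), 0) = (EuclideanSpace.single i (1:ℝ), 0) :=
    fun i => by simp [rf_apply]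
  have h2 : rf m (0, 1) = -(0, 1) := by simp [rf_apply]
  simp only [h1, h2, map_neg]
  congr 1
  rw [fderiv_fun_neg]
  simp

lemma qnorm_rf {m : ℕ} (z : EE m × ℝ) : qnorm (rf m z) = qnorm z := by
  simp [qnorm, rf_apply]

lemma pnorm_sw {m : ℕ} (z : EE m × EE m) : pnorm (sw m z) = pnorm z := by
  simp [pnorm, sw_apply, add_comm]

lemma full (m : ℕ) (i0 : Fin m) (a b : ℝ) (ha : 0 < a) (hab : a < b) (f : ℝ → ℝ)
    (u : EE m × EE m → ℝ) (hreg : ContDiffOn ℝ 2 u (Ann m a b))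
    (hinv : ∀ x ∈ Ann m a b, ∀ x' ∈ Ann m a b, ‖x.1‖ = ‖x'.1‖ → ‖x.2‖ = ‖x'.2‖ → u x = u x')
    (heq : ∀ x ∈ Ann m a b, -lapP u x = f (u x))
    (z : EE m × ℝ) (hz : z ∈ AnnD m a b) :
    ContDiffAt ℝ 2 (fun z => u (Phi (EuclideanSpace.single i0 (1:ℝ)) z)) z ∧
    -lapQ (fun z => u (Phi (EuclideanSpace.single i0 (1:ℝ)) z)) z
      = f (u (Phi (EuclideanSpace.single i0 (1:ℝ)) z)) / (2 * qnorm z) := by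
  by_cases hpos : 0 < qnorm z + z.2
  · exact core m i0 a b ha hab f u hreg hinv heq z hz hpos
  have hq : 0 < qnorm z := lt_trans (by positivity) hz.1
  have hswA : ∀ x ∈ Ann m a b, sw m x ∈ Ann m a b := fun x hx => by
    simpa only [Ann, Set.mem_ofPred_eq, pnorm_sw] using hx
  have hz' : rf m z ∈ AnnD m a b := by
    simpa only [AnnD, Set.mem_ofPred_eq, qnorm_rf] using hz
  have h := core m i0 a b ha hab f (fun y => u (sw m y))
    (hreg.comp (sw m).contDiff.contDiffOn hswA)
    (fun x hx x' hx' h1 h2 => hinv _ (hswA x hx) _ (hswA x' hx') h2 h1)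
    (fun x hx => by rw [lapP_swap]; exact heq _ (hswA x hx))
    (rf m z) hz' (by rw [qnorm_rf, rf_apply]; simp only []; linarith)
  have hP : ∀ w : EE m × ℝ, sw m (Phi (EuclideanSpace.single i0 (1:ℝ)) (rf m w))
      = Phi (EuclideanSpace.single i0 (1:ℝ)) w := fun w => by
    simp only [Phi, qnorm_rf, sw_apply]
    simp [rf_apply, sub_eq_add_neg]
  obtain ⟨h1, h2⟩ := h
  rw [← lapQ_refl] at h2
  simp only [hP, qnorm_rf] at h2
  refine ⟨?_, h2⟩
  have := ContDiffAt.comp z h1 (rf m).contDiff.contDiffAt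
  refine this.congr_of_eventuallyEq (Eventually.of_forall fun w => ?_)
  simp only [Function.comp, hP]

/-- the reduction of STATEMENT 5 with the Neumann boundary condition
`⟨∇u(x), x/|x|⟩ = 0` on `∂A` in place of the Dirichlet condition: the reduced axially symmetric
function `v(z',t) := u(√(|z|+t)·e₁, √(|z|−t)·e₁)` solves `−Δv = f(v)/(2|z|)` in `D` with the
Neumann condition `⟨∇v(z), z/|z|⟩ = 0` on `∂D`. -/
theorem stmt_7 (m : ℕ) (hm : 2 ≤ m) (a b : ℝ) (ha : 0 < a) (hab : a < b)
    (f : ℝ → ℝ) (hf : ContDiff ℝ 1 f)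
    (u : EuclideanSpace ℝ (Fin m) × EuclideanSpace ℝ (Fin m) → ℝ)
    (hreg : ContDiffOn ℝ 2 u (closure (Ann m a b)))
    (hinv : ∀ x ∈ closure (Ann m a b), ∀ x' ∈ closure (Ann m a b),
      ‖x.1‖ = ‖x'.1‖ → ‖x.2‖ = ‖x'.2‖ → u x = u x')
    (heq : ∀ x ∈ Ann m a b, -lapP u x = f (u x))
    (hbd : ∀ x ∈ frontier (Ann m a b),
      fderivWithin ℝ u (closure (Ann m a b)) x ((pnorm x)⁻¹ • x) = 0) :
    ∀ v : EuclideanSpace ℝ (Fin m) × ℝ → ℝ,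
      v = (fun z => u (Real.sqrt (qnorm z + z.2) • EuclideanSpace.single (⟨0, by omega⟩ : Fin m) (1 : ℝ),
        Real.sqrt (qnorm z - z.2) • EuclideanSpace.single (⟨0, by omega⟩ : Fin m) (1 : ℝ))) →
      ContDiffOn ℝ 2 v (AnnD m a b) ∧
      (∀ z ∈ closure (AnnD m a b), ∀ w ∈ closure (AnnD m a b),
        ‖z.1‖ = ‖w.1‖ → z.2 = w.2 → v z = v w) ∧
      (∀ z ∈ AnnD m a b, -lapQ v z = f (v z) / (2 * qnorm z)) ∧
      (∀ z ∈ frontier (AnnD m a b),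
        fderivWithin ℝ v (closure (AnnD m a b)) z ((qnorm z)⁻¹ • z) = 0) := by

  intro v hv
  have hfull := full m ⟨0, by omega⟩ a b ha hab f u (hreg.mono subset_closure)
    (fun x hx x' hx' => hinv x (subset_closure hx) x' (subset_closure hx')) heq
  have hv' : v = fun z => u (Phi (EuclideanSpace.single (⟨0, by omega⟩ : Fin m) (1:ℝ)) z) := hv
  rw [hv']
  refine ⟨fun z hz => (hfull z hz).1.contDiffWithinAt, ?_, fun z hz => (hfull z hz).2, ?_⟩
  · intro z _ w _ h1 h2
    simp only [Phi, qnorm, h1, h2]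
  · intro z hz
    exact neumann m a b ha hab u _ (by simp) hreg hbd z hz
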